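/- (Convergence of the inexact accelerated linearized ADMM.) Under the Problem setup, assume α ≤ 1/L_{f2}, β ≤ t_1²/L_{g2}, and {t_k}_{k≥1} ⊆ [1, +∞) is nondecreasing with t_{k+1}² ≤ t_k² + t_{k+1} and t_{k+1}² ≤ t_k² + (β·μ_g/(1 + β·γ·‖B‖²))·t_k for all k ≥ 1. Let nonnegative error sequences {ε^a_k}_{k≥1} and {ε^b_k}_{k≥1} satisfy Σ_{k=1}^{∞} t_{k+1}·ε^a_k < ∞ and Σ_{k=1}^{∞} ε^b_k < ∞, and let {(x_k, y_k, λ_k, u_k, v_k)}_{k≥1} satisfy the inexact Scheme A: there exist ξ^a_k ∈ ℝ^m, ξ^b_k ∈ ℝ^n with ‖ξ^a_k‖ ≤ ε^a_k, ‖ξ^b_k‖ ≤ ε^b_k such that u_{k+1} − u_k = −α·t_{k+1}·(ξ_{k+1} + ∇f2(x̄_k) + Aᵀλ̄_{k+1} − ξ^a_k) for some ξ_{k+1} ∈ ∂f1(u_{k+1}) and v_{k+1} − v_k = −(β/t_{k+1})·(ζ_{k+1} + ∇g2(ȳ_k) + Bᵀλ_{k+1} − ξ^b_k) for some ζ_{k+1}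 ∈ ∂g1(v_{k+1}), the remaining updates being as in Scheme A with λ̂_{k+1} = λ_{k+1}. Then for every (x*, y*, λ*) ∈ Ω there exist finite constants C₃ and C₄ (depending only on the initial data, the parameters, and the sums of the error sequences) such that for all k ≥ 1: 𝓛(x_k, y_k, λ*) − 𝓛(x*, y*, λ*) ≤ C₃/t_k², ‖A x_k + B y_k − b‖ ≤ C₄/t_k², and |f(x_k) + g(y_k) − f(x*) − g(y*)| ≤ (C₃ + C₄·‖λ*‖)/t_k². -/

import Mathlib

set_option autoImplicit false

open RealInnerProductSpace

/-- The Lagrangian `𝓛(x,y,λ) = f1 x + f2 x + g1 y + g2 y + ⟪λ, Ax + By − b⟫`. -/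
noncomputable def Lagr {m n p : ℕ}
    (f1 f2 : EuclideanSpace ℝ (Fin m) → ℝ)
    (g1 g2 : EuclideanSpace ℝ (Fin n) → ℝ)
    (A : EuclideanSpace ℝ (Fin m) →L[ℝ] EuclideanSpace ℝ (Fin p))
    (B : EuclideanSpace ℝ (Fin n) →L[ℝ] EuclideanSpace ℝ (Fin p))
    (b : EuclideanSpace ℝ (Fin p))
    (x : EuclideanSpace ℝ (Fin m)) (y : EuclideanSpace ℝ (Fin n))
    (l : EuclideanSpace ℝ (Fin p)) : ℝ :=
  f1 x + f2 x + g1 y + g2 y + ⟪l, A x + B y - b⟫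

section ConvexAnalysis

variable {E : Type*} [NormedAddCommGroup E] [InnerProductSpace ℝ E]

lemma hasDerivAt_comp_line [CompleteSpace E] {f : E → ℝ} {f' : E → E}
    (hf : ∀ x, HasGradientAt f (f' x) x) (x d : E) (s : ℝ) :
    HasDerivAt (fun s : ℝ => f (x + s • d)) ⟪f' (x + s • d), d⟫ s := by
  have hline : HasDerivAt (fun s : ℝ => x + s • d) d s := by
    simpa using ((hasDerivAt_id s).smul_const d).const_add x
  exact (hf (x + s • d)).hasFDerivAt.comp_hasDerivAt s hline

lemma ConvexOn.add_inner_gradient_le [CompleteSpace E] {f : E → ℝ} {f' : E → E}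
    (hconv : ConvexOn ℝ Set.univ f) (hf : ∀ x, HasGradientAt f (f' x) x) (x z : E) :
    f x + ⟪f' x, z - x⟫ ≤ f z := by
  have hc : ConvexOn ℝ Set.univ (fun s : ℝ => f (x + s • (z - x))) := by
    refine ⟨convex_univ, fun r _ s _ a b ha hb hab => ?_⟩
    have h := hconv.2 (Set.mem_univ (x + r • (z - x))) (Set.mem_univ (x + s • (z - x))) ha hb hab
    convert h using 2
    obtain rfl : b = 1 - a := by linarith
    simp only [smul_eq_mul]
    module
  have h := hc.le_slope_of_hasDerivAt (Set.mem_univ 0) (Set.mem_univ 1) one_pos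
    (hasDerivAt_comp_line hf x (z - x) 0)
  simp [slope] at h
  linarith

/-- The descent lemma. -/
lemma le_add_inner_gradient_add_sq [CompleteSpace E] {f : E → ℝ} {f' : E → E} {L : ℝ}
    (hf : ∀ x, HasGradientAt f (f' x) x) (hlip : ∀ x y, ‖f' x - f' y‖ ≤ L * ‖x - y‖) (x z : E) :
    f z ≤ f x + ⟪f' x, z - x⟫ + L / 2 * ‖z - x‖ ^ 2 := by
  set d := z - x with hd
  have hderiv (s : ℝ) : HasDerivAt
      (fun s : ℝ => f (x + s • d) - s * ⟪f' x, d⟫ - s ^ 2 * (L / 2 * ‖d‖ ^ 2))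
      (⟪f' (x + s • d), d⟫ - 1 * ⟪f' x, d⟫ - 2 * s * (L / 2 * ‖d‖ ^ 2)) s := by
    have hsq : HasDerivAt (fun s : ℝ => s ^ 2) (2 * s) s := by simpa using hasDerivAt_pow 2 s
    exact ((hasDerivAt_comp_line hf x d s).sub ((hasDerivAt_id s).mul_const _)).sub
      (hsq.mul_const _)
  have hanti := antitoneOn_of_hasDerivWithinAt_nonpos (convex_Icc (0 : ℝ) 1)
    (fun s _ => (hderiv s).continuousAt.continuousWithinAt)
    (fun s _ => (hderiv s).hasDerivWithinAt) (fun s hs => by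
      rw [interior_Icc] at hs
      have h1 : ⟪f' (x + s • d) - f' x, d⟫ ≤ L * (s * ‖d‖) * ‖d‖ := by
        refine (real_inner_le_norm _ _).trans ?_
        gcongr
        simpa [norm_smul, abs_of_pos hs.1] using hlip (x + s • d) x
      rw [inner_sub_left] at h1
      linarith)
  have h := hanti (Set.left_mem_Icc.2 zero_le_one) (Set.right_mem_Icc.2 zero_le_one) zero_le_one
  have hz : x + d = z := by simp [hd]
  simp [hz] at h
  linarith

/-- A subgradient of a strongly convex function satisfies the subgradient inequality with an
additional quadratic term. -/
lemma StrongConvexOn.add_inner_add_sq_le {f : E → ℝ} {μ : ℝ} (hf : StrongConvexOn Set.univ μ f)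
    {u ξ : E} (hξ : ∀ z, f u + ⟪ξ, z - u⟫ ≤ f z) (z : E) :
    f u + ⟪ξ, z - u⟫ + μ / 2 * ‖z - u‖ ^ 2 ≤ f z := by
  have key : ∀ s ∈ Set.Ioo (0 : ℝ) 1,
      f u + ⟪ξ, z - u⟫ + (1 - s) * (μ / 2 * ‖z - u‖ ^ 2) ≤ f z := by
    intro s hs
    have h1 := hf.2 (Set.mem_univ z) (Set.mem_univ u) hs.1.le (sub_nonneg.2 hs.2.le)
      (add_sub_cancel _ _)
    have h2 := hξ (s • z + (1 - s) • u)
    have h3 : s • z + (1 - s) • u - u = s • (z - u) := by module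
    rw [h3, real_inner_smul_right] at h2
    simp only [smul_eq_mul] at h1
    refine le_of_mul_le_mul_left ?_ hs.1
    linarith
  have hlim : Filter.Tendsto (fun s : ℝ => f u + ⟪ξ, z - u⟫ + (1 - s) * (μ / 2 * ‖z - u‖ ^ 2))
      (nhdsWithin 0 (Set.Ioi 0)) (nhds (f u + ⟪ξ, z - u⟫ + (1 - 0) * (μ / 2 * ‖z - u‖ ^ 2))) :=
    (Continuous.tendsto (by fun_prop) 0).mono_left nhdsWithin_le_nhds
  have := le_of_tendsto hlim
    (Filter.eventually_of_mem (Ioo_mem_nhdsGT one_pos) key)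
  linarith

/-- One accelerated, linearized and inexact proximal step on a composite function. -/
lemma accelerated_prox_step [CompleteSpace E] {f h : E → ℝ} {h' : E → E} {L μ T κ : ℝ}
    (hf : StrongConvexOn Set.univ μ f) (hμ : 0 ≤ μ)
    (hh : ConvexOn ℝ Set.univ h) (hgrad : ∀ x, HasGradientAt h (h' x) x)
    (hlip : ∀ x y, ‖h' x - h' y‖ ≤ L * ‖x - y‖) (hT : 1 ≤ T) (hκ : L ≤ κ)
    {x x' xbar u u' ξ w e : E} (hξ : ∀ z, f u' + ⟪ξ, z - u'⟫ ≤ f z)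
    (hxbar : T • xbar = u + (T - 1) • x) (hx' : T • x' = u' + (T - 1) • x)
    (hu' : κ • (u' - u) = -(T • (ξ + h' xbar + w - e))) (z : E) :
    T ^ 2 * (f x' + h x' - (f z + h z)) + κ / 2 * ‖u' - z‖ ^ 2 + T * μ / 2 * ‖u' - z‖ ^ 2 ≤
      T * (T - 1) * (f x + h x - (f z + h z)) + κ / 2 * ‖u - z‖ ^ 2 - T * ⟪w, u' - z⟫
        + T * (‖e‖ * ‖u' - z‖) := by
  have hT0 : 0 < T := by linarith
  have hT1 : 0 ≤ T - 1 := by linarith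
  have hfc : ConvexOn ℝ Set.univ f :=
    UniformConvexOn.convexOn hf fun r => by positivity
  have hx'eq : x' = (1 / T) • u' + ((T - 1) / T) • x := by
    rw [← inv_smul_smul₀ hT0.ne' x', hx', smul_add, smul_smul]
    congr 2 <;> ring
  have hf1 : T * f x' ≤ f u' + (T - 1) * f x := by
    have h := hfc.2 (Set.mem_univ u') (Set.mem_univ x) (by positivity : 0 ≤ 1 / T)
      (by positivity : 0 ≤ (T - 1) / T) (by field_simp; ring)
    rw [← hx'eq] at h
    simp only [smul_eq_mul] at h
    calc T * f x' ≤ T * (1 / T * f u' + (T - 1) / T * f x) := by gcongr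
      _ = _ := by field_simp
  have hsub := hf.add_inner_add_sq_le hξ z
  have hdiff : T • (x' - xbar) = u' - u := by
    rw [smul_sub, hx', hxbar]; abel
  have hsq : T ^ 2 * ‖x' - xbar‖ ^ 2 = ‖u' - u‖ ^ 2 := by
    rw [← hdiff, norm_smul, Real.norm_of_nonneg hT0.le, mul_pow]
  have hdesc := le_add_inner_gradient_add_sq hgrad hlip xbar x'
  have hgx := hh.add_inner_gradient_le hgrad xbar x
  have hgz := hh.add_inner_gradient_le hgrad xbar z
  have hinner : T * ⟪h' xbar, x' - xbar⟫ =
      (T - 1) * ⟪h' xbar, x - xbar⟫ + ⟪h' xbar, z - xbar⟫ + ⟪h' xbar, u' - z⟫ := by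
    rw [← real_inner_smul_right, ← real_inner_smul_right, ← inner_add_right, ← inner_add_right]
    congr 1
    rw [smul_sub, hx']
    module
  have hh1 : T * (T * h x') ≤ T * ((T - 1) * h x + h z + ⟪h' xbar, u' - z⟫)
      + L / 2 * ‖u' - u‖ ^ 2 := by
    have h1 := mul_le_mul_of_nonneg_left hdesc (sq_nonneg T)
    have h2 := mul_le_mul_of_nonneg_left hgx (mul_nonneg hT0.le hT1)
    have h3 := mul_le_mul_of_nonneg_left hgz hT0.le
    have h4 := congrArg (T * ·) hinner
    have h5 := congrArg (L / 2 * ·) hsq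
    beta_reduce at h4 h5
    linarith
  have hstep : κ * ⟪u' - u, u' - z⟫ = -(T * (⟪ξ, u' - z⟫ + ⟪h' xbar, u' - z⟫ + ⟪w, u' - z⟫
      - ⟪e, u' - z⟫)) := by
    rw [← real_inner_smul_left, hu', inner_neg_left, real_inner_smul_left, inner_sub_left,
      inner_add_left, inner_add_left]
  have hthree : ‖u - z‖ ^ 2 = ‖u' - z‖ ^ 2 - 2 * ⟪u' - u, u' - z⟫ + ‖u' - u‖ ^ 2 := by
    have h := norm_sub_sq_real (u' - z) (u' - u)
    rw [sub_sub_sub_cancel_left, real_inner_comm] at h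
    exact h
  have herr := mul_le_mul_of_nonneg_left (real_inner_le_norm e (u' - z)) hT0.le
  have hκ' := mul_le_mul_of_nonneg_right hκ (sq_nonneg ‖u' - u‖)
  have h1 := mul_le_mul_of_nonneg_left hf1 hT0.le
  have h2 := mul_le_mul_of_nonneg_left hsub hT0.le
  rw [← neg_sub u' z, inner_neg_right, norm_neg] at h2
  rw [hthree]
  linarith

/-- The coupling terms of an ADMM step telescope. -/
lemma admm_coupling_le {γ : ℝ} (hγ : 0 < γ) (T : ℝ) (l ls p q q' : E) :
    -(T * ⟪l + (γ * T) • (p + q), p⟫) - T * ⟪l + (γ * T) • (p + q'), q'⟫ + T * ⟪ls, p + q'⟫ ≤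
      1 / (2 * γ) * (‖l - ls‖ ^ 2 - ‖l + (γ * T) • (p + q') - ls‖ ^ 2)
        + γ * T ^ 2 / 2 * (‖q‖ ^ 2 - ‖q'‖ ^ 2) := by
  obtain ⟨d, rfl⟩ : ∃ d, l = ls + d := ⟨l - ls, by abel⟩
  have e1 : ls + d + (γ * T) • (p + q') - ls = d + (γ * T) • (p + q') := by abel
  have h0 : 0 ≤ γ * T ^ 2 / 2 * ‖p + q‖ ^ 2 := by positivity
  have h1 : 1 / (2 * γ) * (‖d‖ ^ 2 - ‖d + (γ * T) • (p + q')‖ ^ 2) =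
      -(T * ⟪d, p + q'⟫) - γ * T ^ 2 / 2 * ‖p + q'‖ ^ 2 := by
    rw [norm_add_sq_real, real_inner_smul_right, norm_smul, mul_pow, Real.norm_eq_abs, sq_abs]
    field_simp
    ring
  rw [e1, add_sub_cancel_left, h1]
  simp only [norm_add_sq_real, inner_add_left, inner_add_right, real_inner_smul_left,
    real_inner_self_eq_norm_sq, real_inner_comm p q] at h0 ⊢
  linarith

end ConvexAnalysis

/-- A discrete Bihari-type inequality. -/
lemma sqrt_le_add_sum {e c : ℕ → ℝ} (he : ∀ k ≥ 1, 0 ≤ e k) (hc : ∀ k ≥ 1, 0 ≤ c k)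
    (hstep : ∀ k ≥ 1, e (k + 1) ≤ e k + c k * √(e (k + 1))) (K : ℕ) :
    √(e (K + 1)) ≤ √(e 1) + ∑ k ∈ Finset.Icc 1 K, c k := by
  induction K with
  | zero => simp
  | succ K ih =>
    rw [Finset.sum_Icc_succ_top (by lia)]
    suffices √(e (K + 1 + 1)) ≤ √(e (K + 1)) + c (K + 1) by linarith
    by_contra! hlt
    have h := hstep (K + 1) (by lia)
    have h1 := Real.mul_self_sqrt (he (K + 1) (by lia))
    have h2 := Real.mul_self_sqrt (he (K + 1 + 1) (by lia))
    have h3 := Real.sqrt_nonneg (e (K + 1))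
    have h4 := hc (K + 1) (by lia)
    nlinarith

/-- If `a` is driven by the increments of a bounded sequence `l` and contracted by factors
`1 - q k` in `[0, 1]`, then `a` is bounded. -/
lemma norm_le_of_contracted_increments {E : Type*} [NormedAddCommGroup E] [NormedSpace ℝ E]
    {a l : ℕ → E} {q : ℕ → ℝ} {R : ℝ} (hq0 : ∀ k ≥ 1, 0 ≤ q k) (hq1 : ∀ k ≥ 1, q k ≤ 1)
    (hl : ∀ k ≥ 1, ‖l k‖ ≤ R)
    (hstep : ∀ k ≥ 1, a (k + 1) = (1 - q k) • a k + (l (k + 1) - l k)) :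
    ∀ k ≥ 1, ‖a k‖ ≤ ‖a 1‖ + 2 * R := by
  have hR : 0 ≤ R := (norm_nonneg _).trans (hl 1 le_rfl)
  have key : ∀ k ≥ 1, ‖a k - l k‖ ≤ ‖a 1‖ + R := by
    intro k hk
    induction k, hk using Nat.le_induction with
    | base => exact (norm_sub_le _ _).trans (by gcongr; exact hl 1 le_rfl)
    | succ k hk ih =>
      have h0 := hq0 k hk
      have h1 : 0 ≤ 1 - q k := sub_nonneg.2 (hq1 k hk)
      have heq : a (k + 1) - l (k + 1) = (1 - q k) • (a k - l k) - q k • l k := by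
        rw [hstep k hk]; module
      have hlk : ‖l k‖ ≤ ‖a 1‖ + R := (hl k hk).trans (by simp)
      calc ‖a (k + 1) - l (k + 1)‖ ≤ ‖(1 - q k) • (a k - l k)‖ + ‖q k • l k‖ := by
            rw [heq]; exact norm_sub_le _ _
        _ = (1 - q k) * ‖a k - l k‖ + q k * ‖l k‖ := by
            rw [norm_smul, norm_smul, Real.norm_of_nonneg h0, Real.norm_of_nonneg h1]
        _ ≤ (1 - q k) * (‖a 1‖ + R) + q k * (‖a 1‖ + R) := by gcongr
        _ = ‖a 1‖ + R := by ring
  intro k hk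
  calc ‖a k‖ = ‖(a k - l k) + l k‖ := by simp
    _ ≤ ‖a k - l k‖ + ‖l k‖ := norm_add_le _ _
    _ ≤ (‖a 1‖ + R) + R := add_le_add (key k hk) (hl k hk)
    _ = _ := by ring

/-- If the multipliers are bounded, then the residuals decay like `1 / t k ^ 2`. -/
lemma norm_sq_smul_residual_le {E : Type*} [NormedAddCommGroup E] [NormedSpace ℝ E] {γ D : ℝ}
    (hγ : 0 < γ) {t : ℕ → ℝ} (ht1 : ∀ k ≥ 1, 1 ≤ t k)
    (htrec : ∀ k ≥ 1, t (k + 1) ^ 2 ≤ t k ^ 2 + t (k + 1)) {r s lam : ℕ → E} {lams : E}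
    (hlam : ∀ k ≥ 1, ‖lam k - lams‖ ≤ D)
    (hr : ∀ k ≥ 1, t (k + 1) • r (k + 1) = s (k + 1) + (t (k + 1) - 1) • r k)
    (hstep : ∀ k ≥ 1, lam (k + 1) = lam k + (γ * t (k + 1)) • s (k + 1)) :
    ∀ k ≥ 1, ‖t k ^ 2 • r k‖ ≤ ‖t 1 ^ 2 • r 1‖ + 2 * (γ⁻¹ * D) := by
  refine norm_le_of_contracted_increments (a := fun k => t k ^ 2 • r k)
    (l := fun k => γ⁻¹ • (lam k - lams))
    (q := fun k => (t k ^ 2 - t (k + 1) * (t (k + 1) - 1)) / t k ^ 2) ?_ ?_ ?_ ?_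
  · intro k hk
    exact div_nonneg (by linarith [htrec k hk]) (sq_nonneg _)
  · intro k hk
    have := ht1 (k + 1) (by lia)
    have : 0 < t k := one_pos.trans_le (ht1 k hk)
    rw [div_le_one (by positivity)]
    nlinarith
  · intro k hk
    rw [norm_smul, norm_inv, Real.norm_of_nonneg hγ.le]
    gcongr
    exact hlam k hk
  · intro k hk
    have htk : t k ≠ 0 := (one_pos.trans_le (ht1 k hk)).ne'
    have h1 : γ⁻¹ • (lam (k + 1) - lams) - γ⁻¹ • (lam k - lams) = t (k + 1) • s (k + 1) := by
      rw [hstep k hk, ← smul_sub, sub_sub_sub_cancel_right, add_sub_cancel_left, smul_smul,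
        inv_mul_cancel_left₀ hγ.ne']
    have h2 : (1 - (t k ^ 2 - t (k + 1) * (t (k + 1) - 1)) / t k ^ 2) * t k ^ 2 =
        t (k + 1) * (t (k + 1) - 1) := by
      field_simp
      ring
    rw [h1, smul_smul, h2, eq_sub_of_add_eq (hr k hk).symm]
    module

/-- The extrapolated point is a convex combination of the previous iterate and the auxiliary
sequence. -/
lemma smul_extrapolation_eq {E : Type*} [AddCommGroup E] [Module ℝ E] {t : ℕ → ℝ}
    {x u xbar : ℕ → E} (ht : ∀ k ≥ 1, 1 ≤ t k) (hx0 : x 0 = x 1) (hu1 : u 1 = x 1)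
    (hxbar : ∀ k ≥ 1, xbar k = x k + ((t k - 1) / t (k + 1)) • (x k - x (k - 1)))
    (hxupd : ∀ k ≥ 1, t (k + 1) • x (k + 1) = u (k + 1) + (t (k + 1) - 1) • x k)
    {k : ℕ} (hk : 1 ≤ k) :
    t (k + 1) • xbar k = u k + (t (k + 1) - 1) • x k := by
  have hT : t (k + 1) ≠ 0 := by linarith [ht (k + 1) (by lia)]
  have hu : u k = x k + (t k - 1) • (x k - x (k - 1)) := by
    obtain rfl | ⟨j, hj, rfl⟩ : k = 1 ∨ ∃ j ≥ 1, k = j + 1 := by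
      rcases hk.eq_or_lt with h | h
      · exact Or.inl h.symm
      · exact Or.inr ⟨k - 1, by lia, by lia⟩
    · simp [hx0, hu1]
    · have := hxupd j hj
      rw [Nat.add_sub_cancel, ← sub_eq_iff_eq_add.2 this]
      module
  rw [hxbar k hk, hu, smul_add, smul_smul, mul_div_cancel₀ _ hT]
  module

lemma smul_average_eq {E : Type*} [AddCommGroup E] [Module ℝ E] {T : ℝ} (hT : T ≠ 0)
    {x' u x : E} (h : x' = (1 / T) • u + ((T - 1) / T) • x) : T • x' = u + (T - 1) • x := by
  rw [h, smul_add, smul_smul, smul_smul, mul_one_div_cancel hT, mul_div_cancel₀ _ hT, one_smul]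

lemma le_sqrt_mul_sqrt {c s V : ℝ} (hc : 0 < c) (h : 1 / c / 2 * s ^ 2 ≤ V) :
    s ≤ √(2 * c) * √V := by
  rw [← Real.sqrt_mul (by positivity)]
  refine Real.le_sqrt_of_sq_le ?_
  calc s ^ 2 = 2 * c * (1 / c / 2 * s ^ 2) := by field_simp
    _ ≤ 2 * c * V := by gcongr

/-- The growth allowed for the weights `t k ^ 2` is absorbed by the strong convexity term. -/
lemma sq_weight_mul_le {β γ μ N t t' a c : ℝ} (hβ : 0 < β) (hγ : 0 < γ) (hμ : 0 < μ) (ht : 0 < t)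
    (hrec : t' ^ 2 ≤ t ^ 2 + β * μ / (1 + β * γ * N ^ 2) * t) (ha : 0 ≤ a) (hc : 0 ≤ c)
    (hca : c ≤ N ^ 2 * a) :
    t' ^ 2 * (a / (2 * β) + γ / 2 * c) ≤
      t ^ 2 * (a / (2 * β) + γ / 2 * c) + t * μ / 2 * a := by
  have hle : a / (2 * β) + γ / 2 * c ≤ (1 + β * γ * N ^ 2) / (2 * β) * a := by
    calc a / (2 * β) + γ / 2 * c ≤ a / (2 * β) + γ / 2 * (N ^ 2 * a) := by gcongr
      _ = _ := by field_simp
  have hpos : 0 < 1 + β * γ * N ^ 2 := by positivity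
  have h1 := mul_le_mul_of_nonneg_right hrec (by positivity : 0 ≤ a / (2 * β) + γ / 2 * c)
  have h2 := mul_le_mul_of_nonneg_left hle
    (by positivity : 0 ≤ β * μ / (1 + β * γ * N ^ 2) * t)
  have h3 : β * μ / (1 + β * γ * N ^ 2) * t * ((1 + β * γ * N ^ 2) / (2 * β) * a) =
      t * μ / 2 * a := by field_simp
  linarith

section ADMM

variable {E F G : Type*} [NormedAddCommGroup E] [InnerProductSpace ℝ E]
  [NormedAddCommGroup F] [InnerProductSpace ℝ F] [NormedAddCommGroup G] [InnerProductSpace ℝ G]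

lemma smul_residual_eq (A : E →L[ℝ] G) (B : F →L[ℝ] G) (b : G) {T : ℝ} {x x' u' : E} {y y' v' : F}
    (hx' : T • x' = u' + (T - 1) • x) (hy' : T • y' = v' + (T - 1) • y) :
    T • (A x' + B y' - b) = (A u' + B v' - b) + (T - 1) • (A x + B y - b) := by
  rw [smul_sub, smul_add, ← map_smul, ← map_smul, hx', hy']
  simp only [map_add, map_smul]
  module

/-- One step of the inexact accelerated linearized ADMM. -/
lemma admm_step [CompleteSpace E] [CompleteSpace F] [CompleteSpace G]
    {A : E →L[ℝ] G} {B : F →L[ℝ] G} {b : G} {f1 f2 : E → ℝ} {g1 g2 : F → ℝ}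
    {f2' : E → E} {g2' : F → F} {Lf Lg μ α β γ T : ℝ}
    (hα : 0 < α) (hβ : 0 < β) (hγ : 0 < γ) (hμ : 0 ≤ μ)
    (hf1 : ConvexOn ℝ Set.univ f1)
    (hf2 : ConvexOn ℝ Set.univ f2) (hf2grad : ∀ x, HasGradientAt f2 (f2' x) x)
    (hf2lip : ∀ x y, ‖f2' x - f2' y‖ ≤ Lf * ‖x - y‖)
    (hg1 : StrongConvexOn Set.univ μ g1)
    (hg2 : ConvexOn ℝ Set.univ g2) (hg2grad : ∀ y, HasGradientAt g2 (g2' y) y)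
    (hg2lip : ∀ x y, ‖g2' x - g2' y‖ ≤ Lg * ‖x - y‖)
    (hT : 1 ≤ T) (hLα : Lf ≤ 1 / α) (hLβ : Lg ≤ T ^ 2 / β)
    {x x' xbar u u' ξ ea xs : E} {y y' ybar v v' ζ eb ys : F} {l l' lbar : G}
    (hξ : ∀ z, f1 u' + ⟪ξ, z - u'⟫ ≤ f1 z) (hζ : ∀ z, g1 v' + ⟪ζ, z - v'⟫ ≤ g1 z)
    (hfeas : A xs + B ys - b = 0)
    (hxbar : T • xbar = u + (T - 1) • x) (hx' : T • x' = u' + (T - 1) • x)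
    (hybar : T • ybar = v + (T - 1) • y) (hy' : T • y' = v' + (T - 1) • y)
    (hu' : u' - u = -((α * T) • (ξ + f2' xbar + ContinuousLinearMap.adjoint A lbar - ea)))
    (hv' : v' - v = -((β / T) • (ζ + g2' ybar + ContinuousLinearMap.adjoint B l' - eb)))
    (hl' : l' = l + (γ * T) • (A u' + B v' - b))
    (hlbar : lbar = l + (γ * T) • (A u' + B v - b)) (ls : G) :
    T ^ 2 * (f1 x' + f2 x' - (f1 xs + f2 xs) + (g1 y' + g2 y' - (g1 ys + g2 ys))
        + ⟪ls, A x' + B y' - b⟫)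
      + 1 / α / 2 * ‖u' - xs‖ ^ 2
      + T ^ 2 * (‖v' - ys‖ ^ 2 / (2 * β) + γ / 2 * ‖B (v' - ys)‖ ^ 2)
      + T * μ / 2 * ‖v' - ys‖ ^ 2 + 1 / (2 * γ) * ‖l' - ls‖ ^ 2 ≤
    T * (T - 1) * (f1 x + f2 x - (f1 xs + f2 xs) + (g1 y + g2 y - (g1 ys + g2 ys))
        + ⟪ls, A x + B y - b⟫)
      + 1 / α / 2 * ‖u - xs‖ ^ 2
      + T ^ 2 * (‖v - ys‖ ^ 2 / (2 * β) + γ / 2 * ‖B (v - ys)‖ ^ 2)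
      + 1 / (2 * γ) * ‖l - ls‖ ^ 2
      + T * (‖ea‖ * ‖u' - xs‖) + T * (‖eb‖ * ‖v' - ys‖) := by
  have hT0 : 0 < T := one_pos.trans_le hT
  have hX := accelerated_prox_step (κ := 1 / α) (strongConvexOn_zero.2 hf1) le_rfl hf2
    hf2grad hf2lip hT hLα hξ hxbar hx'
    (by rw [hu', smul_neg, smul_smul]; congr 2; field_simp) xs
  have hY := accelerated_prox_step (κ := T ^ 2 / β) hg1 hμ hg2 hg2grad hg2lip hT hLβ hζ hybar hy'
    (by rw [hv', smul_neg, smul_smul]; congr 2; field_simp) ys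
  rw [ContinuousLinearMap.adjoint_inner_left] at hX hY
  have hs (w : F) : A u' + B w - b = A (u' - xs) + B (w - ys) := by
    rw [← sub_zero (A u' + B w - b), ← hfeas, map_sub, map_sub]
    abel
  have hC := admm_coupling_le hγ T l ls (A (u' - xs)) (B (v - ys)) (B (v' - ys))
  rw [← hs, ← hs, ← hl', ← hlbar] at hC
  have hR := congrArg (fun z => T * ⟪ls, z⟫) (smul_residual_eq A B b hx' hy')
  simp only [inner_add_right _ (A u' + B v' - b), real_inner_smul_right] at hR
  have hW (w : F) : T ^ 2 * (‖w - ys‖ ^ 2 / (2 * β) + γ / 2 * ‖B (w - ys)‖ ^ 2) =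
      T ^ 2 / β / 2 * ‖w - ys‖ ^ 2 + γ * T ^ 2 / 2 * ‖B (w - ys)‖ ^ 2 := by field_simp
  rw [hW, hW]
  linarith

end ADMM

/-- Convergence of the inexact accelerated linearized ADMM (Theorem 4.3): Scheme A with
`λ̂_{k+1} = λ_{k+1}` where the two subproblems are solved up to errors `ε^a_k`, `ε^b_k`
with `Σ t_{k+1} ε^a_k < ∞` and `Σ ε^b_k < ∞`. -/
theorem stmt19 {m n p : ℕ}
    (A : EuclideanSpace ℝ (Fin m) →L[ℝ] EuclideanSpace ℝ (Fin p))
    (B : EuclideanSpace ℝ (Fin n) →L[ℝ] EuclideanSpace ℝ (Fin p))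
    (b : EuclideanSpace ℝ (Fin p))
    (f1 f2 : EuclideanSpace ℝ (Fin m) → ℝ)
    (g1 g2 : EuclideanSpace ℝ (Fin n) → ℝ)
    (f2' : EuclideanSpace ℝ (Fin m) → EuclideanSpace ℝ (Fin m))
    (g2' : EuclideanSpace ℝ (Fin n) → EuclideanSpace ℝ (Fin n))
    (Lf2 Lg2 μ : ℝ) (hLf2 : 0 ≤ Lf2) (hLg2 : 0 ≤ Lg2) (hμ : 0 < μ)
    -- Assumption 1.1
    (hf1lsc : LowerSemicontinuous f1) (hf1conv : ConvexOn ℝ Set.univ f1)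
    (hf2conv : ConvexOn ℝ Set.univ f2)
    (hf2grad : ∀ x, HasGradientAt f2 (f2' x) x)
    (hf2lip : ∀ x y, ‖f2' x - f2' y‖ ≤ Lf2 * ‖x - y‖)
    (hg1lsc : LowerSemicontinuous g1) (hg1sc : StrongConvexOn Set.univ μ g1)
    (hg2conv : ConvexOn ℝ Set.univ g2)
    (hg2grad : ∀ y, HasGradientAt g2 (g2' y) y)
    (hg2lip : ∀ x y, ‖g2' x - g2' y‖ ≤ Lg2 * ‖x - y‖)
    -- parameters
    (α β γ : ℝ) (hα : 0 < α) (hβ : 0 < β) (hγ : 0 < γ)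
    (t : ℕ → ℝ) (ht1 : ∀ k ≥ 1, 1 ≤ t k) (htmono : ∀ k ≥ 1, t k ≤ t (k + 1))
    (hαle : α ≤ 1 / Lf2) (hβle : β ≤ t 1 ^ 2 / Lg2)
    (htrec : ∀ k ≥ 1, t (k + 1) ^ 2 ≤ t k ^ 2 + t (k + 1))
    (htrec2 : ∀ k ≥ 1,
      t (k + 1) ^ 2 ≤ t k ^ 2 + β * μ / (1 + β * γ * ‖B‖ ^ 2) * t k)
    -- error sequences
    (εa εb : ℕ → ℝ) (hεa : ∀ k ≥ 1, 0 ≤ εa k) (hεb : ∀ k ≥ 1, 0 ≤ εb k)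
    (hsuma : ∃ Sa : ℝ, ∀ K : ℕ, ∑ k ∈ Finset.Icc 1 K, t (k + 1) * εa k ≤ Sa)
    (hsumb : ∃ Sb : ℝ, ∀ K : ℕ, ∑ k ∈ Finset.Icc 1 K, εb k ≤ Sb)
    -- iterates of the inexact Scheme A with λ̂ = λ
    (x u xbar : ℕ → EuclideanSpace ℝ (Fin m))
    (y v ybar : ℕ → EuclideanSpace ℝ (Fin n))
    (lam lambar : ℕ → EuclideanSpace ℝ (Fin p))
    (ξ ea : ℕ → EuclideanSpace ℝ (Fin m)) (ζ eb : ℕ → EuclideanSpace ℝ (Fin n))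
    (hea : ∀ k ≥ 1, ‖ea k‖ ≤ εa k) (heb : ∀ k ≥ 1, ‖eb k‖ ≤ εb k)
    (hx0 : x 0 = x 1) (hy0 : y 0 = y 1) (hu1 : u 1 = x 1) (hv1 : v 1 = y 1)
    (hxbar : ∀ k ≥ 1, xbar k = x k + ((t k - 1) / t (k + 1)) • (x k - x (k - 1)))
    (hybar : ∀ k ≥ 1, ybar k = y k + ((t k - 1) / t (k + 1)) • (y k - y (k - 1)))
    (hξ : ∀ k ≥ 1, ∀ z, f1 (u (k + 1)) + ⟪ξ (k + 1), z - u (k + 1)⟫ ≤ f1 z)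
    (hu : ∀ k ≥ 1, u (k + 1) - u k =
      -((α * t (k + 1)) • (ξ (k + 1) + f2' (xbar k) +
        ContinuousLinearMap.adjoint A (lambar (k + 1)) - ea k)))
    (hζ : ∀ k ≥ 1, ∀ z, g1 (v (k + 1)) + ⟪ζ (k + 1), z - v (k + 1)⟫ ≤ g1 z)
    (hv : ∀ k ≥ 1, v (k + 1) - v k =
      -((β / t (k + 1)) • (ζ (k + 1) + g2' (ybar k) +
        ContinuousLinearMap.adjoint B (lam (k + 1)) - eb k)))
    (hxupd : ∀ k ≥ 1, x (k + 1) =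
      (1 / t (k + 1)) • u (k + 1) + ((t (k + 1) - 1) / t (k + 1)) • x k)
    (hyupd : ∀ k ≥ 1, y (k + 1) =
      (1 / t (k + 1)) • v (k + 1) + ((t (k + 1) - 1) / t (k + 1)) • y k)
    (hlam : ∀ k ≥ 1, lam (k + 1) =
      lam k + (γ * t (k + 1)) • (A (u (k + 1)) + B (v (k + 1)) - b))
    (hlambar : ∀ k ≥ 1, lambar (k + 1) =
      lam k + (γ * t (k + 1)) • (A (u (k + 1)) + B (v k) - b))
    -- saddle point
    (xs : EuclideanSpace ℝ (Fin m)) (ys : EuclideanSpace ℝ (Fin n))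
    (lams : EuclideanSpace ℝ (Fin p))
    (hsaddle : ∀ xx yy ll,
      Lagr f1 f2 g1 g2 A B b xs ys ll ≤ Lagr f1 f2 g1 g2 A B b xs ys lams ∧
      Lagr f1 f2 g1 g2 A B b xs ys lams ≤ Lagr f1 f2 g1 g2 A B b xx yy lams) :
    -- conclusion
    ∃ C3 C4 : ℝ, ∀ k ≥ 1,
      Lagr f1 f2 g1 g2 A B b (x k) (y k) lams -
          Lagr f1 f2 g1 g2 A B b xs ys lams ≤ C3 / t k ^ 2 ∧
      ‖A (x k) + B (y k) - b‖ ≤ C4 / t k ^ 2 ∧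
      |f1 (x k) + f2 (x k) + g1 (y k) + g2 (y k) -
          (f1 xs + f2 xs + g1 ys + g2 ys)| ≤ (C3 + C4 * ‖lams‖) / t k ^ 2 := by
  have ht0 : ∀ k ≥ 1, 0 < t k := fun k hk => one_pos.trans_le (ht1 k hk)
  have hLα : Lf2 ≤ 1 / α := by
    have hL : 0 < Lf2 := hLf2.lt_of_ne (by rintro rfl; simp at hαle; linarith)
    rwa [le_div_comm₀ hL hα]
  have hLβ : Lg2 ≤ t 1 ^ 2 / β := by
    have hL : 0 < Lg2 := hLg2.lt_of_ne (by rintro rfl; simp at hβle; linarith)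
    rw [le_div_iff₀ hL] at hβle
    rw [le_div_iff₀ hβ]
    linarith
  have ht1le : ∀ k ≥ 1, t 1 ≤ t k := fun k hk => by
    induction k, hk using Nat.le_induction with
    | base => rfl
    | succ k hk ih => exact ih.trans (htmono k hk)
  have hfeas : A xs + B ys - b = 0 := by
    have h := (hsaddle xs ys (lams + (A xs + B ys - b))).1
    simp only [Lagr, inner_add_left, real_inner_self_eq_norm_sq] at h
    have h2 : ‖A xs + B ys - b‖ ^ 2 ≤ 0 := by linarith
    simpa using h2
  have hxupd' : ∀ k ≥ 1, t (k + 1) • x (k + 1) = u (k + 1) + (t (k + 1) - 1) • x k :=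
    fun k hk => smul_average_eq (ht0 (k + 1) (by lia)).ne' (hxupd k hk)
  have hyupd' : ∀ k ≥ 1, t (k + 1) • y (k + 1) = v (k + 1) + (t (k + 1) - 1) • y k :=
    fun k hk => smul_average_eq (ht0 (k + 1) (by lia)).ne' (hyupd k hk)
  obtain ⟨r, hr⟩ : ∃ r : ℕ → EuclideanSpace ℝ (Fin p), ∀ k, r k = A (x k) + B (y k) - b :=
    ⟨_, fun _ => rfl⟩
  have hrupd : ∀ k ≥ 1, t (k + 1) • r (k + 1) =
      (A (u (k + 1)) + B (v (k + 1)) - b) + (t (k + 1) - 1) • r k := fun k hk => by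
    rw [hr, hr]
    exact smul_residual_eq A B b (hxupd' k hk) (hyupd' k hk)
  obtain ⟨δ, hδ⟩ : ∃ δ : ℕ → ℝ, ∀ k, δ k = Lagr f1 f2 g1 g2 A B b (x k) (y k) lams -
    Lagr f1 f2 g1 g2 A B b xs ys lams := ⟨_, fun _ => rfl⟩
  have hδ0 : ∀ k, 0 ≤ δ k := fun k => by
    rw [hδ]
    exact sub_nonneg.2 (hsaddle (x k) (y k) lams).2
  have hδeq : ∀ k, f1 (x k) + f2 (x k) - (f1 xs + f2 xs) +
      (g1 (y k) + g2 (y k) - (g1 ys + g2 ys)) + ⟪lams, A (x k) + B (y k) - b⟫ = δ k := fun k => by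
    simp only [hδ, Lagr, hfeas, inner_zero_right]
    ring
  obtain ⟨W, hW⟩ : ∃ W : ℕ → ℝ, ∀ k,
    W k = ‖v k - ys‖ ^ 2 / (2 * β) + γ / 2 * ‖B (v k - ys)‖ ^ 2 := ⟨_, fun _ => rfl⟩
  obtain ⟨V, hV⟩ : ∃ V : ℕ → ℝ, ∀ k, V k = t k ^ 2 * δ k + 1 / α / 2 * ‖u k - xs‖ ^ 2
    + t (k + 1) ^ 2 * W k + 1 / (2 * γ) * ‖lam k - lams‖ ^ 2 := ⟨_, fun _ => rfl⟩
  have hW0 : ∀ k, 0 ≤ W k := fun k => by rw [hW]; positivity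
  have hV0 : ∀ k, 0 ≤ V k := fun k => by
    rw [hV]
    have := hδ0 k
    have := hW0 k
    positivity
  have hVδ : ∀ k, t k ^ 2 * δ k ≤ V k := fun k => by
    have := hW0 k
    have : 0 ≤ 1 / α / 2 * ‖u k - xs‖ ^ 2 + t (k + 1) ^ 2 * W k
      + 1 / (2 * γ) * ‖lam k - lams‖ ^ 2 := by positivity
    simp only [hV]
    linarith
  have hVu : ∀ k, ‖u k - xs‖ ≤ √(2 * α) * √(V k) := fun k => by
    refine le_sqrt_mul_sqrt hα ?_
    have := hδ0 k
    have := hW0 k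
    have h : 0 ≤ t k ^ 2 * δ k + t (k + 1) ^ 2 * W k + 1 / (2 * γ) * ‖lam k - lams‖ ^ 2 := by
      positivity
    simp only [hV]
    linarith
  have hVv : ∀ k, t (k + 1) * ‖v k - ys‖ ≤ √(2 * β) * √(V k) := fun k => by
    refine le_sqrt_mul_sqrt hβ ?_
    have := hδ0 k
    have h : 0 ≤ t k ^ 2 * δ k + 1 / α / 2 * ‖u k - xs‖ ^ 2
      + t (k + 1) ^ 2 * (γ / 2 * ‖B (v k - ys)‖ ^ 2)
      + 1 / (2 * γ) * ‖lam k - lams‖ ^ 2 := by positivity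
    have h2 : t (k + 1) ^ 2 * (‖v k - ys‖ ^ 2 / (2 * β)) =
      1 / β / 2 * (t (k + 1) * ‖v k - ys‖) ^ 2 := by ring
    simp only [hV, hW]
    linarith
  have hVl : ∀ k, ‖lam k - lams‖ ≤ √(2 * γ) * √(V k) := fun k => by
    refine le_sqrt_mul_sqrt hγ ?_
    have := hδ0 k
    have := hW0 k
    have h : 0 ≤ t k ^ 2 * δ k + 1 / α / 2 * ‖u k - xs‖ ^ 2 + t (k + 1) ^ 2 * W k := by positivity
    have h2 : 1 / γ / 2 * ‖lam k - lams‖ ^ 2 = 1 / (2 * γ) * ‖lam k - lams‖ ^ 2 := by ring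
    simp only [hV]
    linarith
  have hWstep : ∀ k ≥ 1, t (k + 1) ^ 2 * W k ≤ t k ^ 2 * W k + t k * μ / 2 * ‖v k - ys‖ ^ 2 := by
    intro k hk
    have hBv : ‖B (v k - ys)‖ ^ 2 ≤ ‖B‖ ^ 2 * ‖v k - ys‖ ^ 2 := by
      rw [← mul_pow]
      gcongr
      exact B.le_opNorm _
    rw [hW]
    exact sq_weight_mul_le hβ hγ hμ (ht0 k hk) (htrec2 k hk) (by positivity) (by positivity) hBv
  have hVstep : ∀ k ≥ 1, V (k + 1) ≤
      V k + (√(2 * α) * (t (k + 1) * εa k) + √(2 * β) * εb k) * √(V (k + 1)) := by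
    intro k hk
    have hT1 : 1 ≤ t (k + 1) := ht1 (k + 1) (by lia)
    have hT0 := ht0 (k + 1) (by lia)
    have hβT : Lg2 ≤ t (k + 1) ^ 2 / β :=
      hLβ.trans (by have := ht0 1 le_rfl; have := ht1le (k + 1) (by lia); gcongr)
    have hmain := admm_step hα hβ hγ hμ.le hf1conv hf2conv hf2grad hf2lip hg1sc hg2conv hg2grad
      hg2lip hT1 hLα hβT (hξ k hk) (hζ k hk) hfeas
      (smul_extrapolation_eq ht1 hx0 hu1 hxbar hxupd' hk) (hxupd' k hk)
      (smul_extrapolation_eq ht1 hy0 hv1 hybar hyupd' hk) (hyupd' k hk)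
      (hu k hk) (hv k hk) (hlam k hk) (hlambar k hk) lams
    rw [hδeq, hδeq, ← hW, ← hW] at hmain
    have hδstep : t (k + 1) * (t (k + 1) - 1) * δ k ≤ t k ^ 2 * δ k :=
      mul_le_mul_of_nonneg_right (by linarith [htrec k hk]) (hδ0 k)
    have hWk := hWstep (k + 1) (by lia)
    have hea' : t (k + 1) * (‖ea k‖ * ‖u (k + 1) - xs‖) ≤
        √(2 * α) * (t (k + 1) * εa k) * √(V (k + 1)) := by
      calc t (k + 1) * (‖ea k‖ * ‖u (k + 1) - xs‖)
          ≤ t (k + 1) * (εa k * (√(2 * α) * √(V (k + 1)))) := by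
            have := hεa k hk
            gcongr
            · exact hea k hk
            · exact hVu (k + 1)
        _ = _ := by ring
    have heb' : t (k + 1) * (‖eb k‖ * ‖v (k + 1) - ys‖) ≤ √(2 * β) * εb k * √(V (k + 1)) := by
      calc t (k + 1) * (‖eb k‖ * ‖v (k + 1) - ys‖)
          = ‖eb k‖ * (t (k + 1) * ‖v (k + 1) - ys‖) := by ring
        _ ≤ εb k * (√(2 * β) * √(V (k + 1))) := by
            have := hεb k hk
            refine mul_le_mul (heb k hk) (le_trans ?_ (hVv (k + 1))) (by positivity) this
            gcongr
            exact htmono (k + 1) (by lia)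
        _ = _ := by ring
    have hVk := hV k
    have hVk' := hV (k + 1)
    linarith
  obtain ⟨Sa, hSa⟩ := hsuma
  obtain ⟨Sb, hSb⟩ := hsumb
  set R := √(V 1) + (√(2 * α) * Sa + √(2 * β) * Sb) with hRdef
  have hVR : ∀ k ≥ 1, √(V k) ≤ R := by
    intro k hk
    obtain ⟨K, rfl⟩ := Nat.exists_eq_add_of_le' hk
    refine (sqrt_le_add_sum (fun k _ => hV0 k) (fun k hk => ?_) hVstep K).trans ?_
    · have := hεa k hk
      have := hεb k hk
      have := ht0 (k + 1) (by lia)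
      positivity
    · rw [Finset.sum_add_distrib, ← Finset.mul_sum, ← Finset.mul_sum, hRdef]
      gcongr
      · exact hSa K
      · exact hSb K
  have hrbound : ∀ k ≥ 1, ‖t k ^ 2 • r k‖ ≤
      ‖t 1 ^ 2 • r 1‖ + 2 * (γ⁻¹ * (√(2 * γ) * R)) :=
    norm_sq_smul_residual_le hγ ht1 htrec (fun k hk => (hVl k).trans (by gcongr; exact hVR k hk))
      (s := fun k => A (u k) + B (v k) - b) hrupd hlam
  refine ⟨R ^ 2, ‖t 1 ^ 2 • r 1‖ + 2 * (γ⁻¹ * (√(2 * γ) * R)), fun k hk => ?_⟩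
  have htk : 0 < t k ^ 2 := pow_pos (ht0 k hk) 2
  have hgap : δ k ≤ R ^ 2 / t k ^ 2 := by
    rw [le_div_iff₀ htk, mul_comm]
    exact (hVδ k).trans ((Real.sqrt_le_left ((Real.sqrt_nonneg _).trans (hVR k hk))).1 (hVR k hk))
  have hres : ‖r k‖ ≤ (‖t 1 ^ 2 • r 1‖ + 2 * (γ⁻¹ * (√(2 * γ) * R))) / t k ^ 2 := by
    rw [le_div_iff₀ htk, mul_comm]
    simpa [norm_smul] using hrbound k hk
  rw [← hδ, ← hr]
  refine ⟨hgap, hres, ?_⟩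
  have hval : f1 (x k) + f2 (x k) + g1 (y k) + g2 (y k) - (f1 xs + f2 xs + g1 ys + g2 ys) =
      δ k - ⟪lams, r k⟫ := by
    rw [← hδeq, ← hr]; ring
  calc _ = |δ k - ⟪lams, r k⟫| := by rw [hval]
    _ ≤ |δ k| + |⟪lams, r k⟫| := abs_sub _ _
    _ ≤ δ k + ‖lams‖ * ‖r k‖ := by
        rw [abs_of_nonneg (hδ0 k)]
        gcongr
        exact abs_real_inner_le_norm _ _
    _ ≤ R ^ 2 / t k ^ 2 +
        ‖lams‖ * ((‖t 1 ^ 2 • r 1‖ + 2 * (γ⁻¹ * (√(2 * γ) * R))) / t k ^ 2) := by gcongr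
    _ = _ := by ring
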